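/- Let n ≥ 2, let L ∈ ℝ^{n×n} be an irreducible Laplacian matrix, and let r > 0 and s₀ > 0. Then: (a) the matrix s₀²I + (s₀r + 1)L is invertible and every entry of (s₀²I + (s₀r + 1)L)^{-1} is strictly positive; (b) the matrix s₀(s₀²I + (s₀r + 1)L)^{-1}(s₀I + rL) is row stochastic with every entry strictly between 0 and 1, so that I − s₀(s₀²I + (s₀r + 1)L)^{-1}(s₀I + rL) has strictly positive diagonal entries and strictly negative off-diagonal entries. -/

import Mathlib

open Matrix

/-- `L` is a Laplacian matrix: nonpositive off-diagonal entries and zero row sums. -/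
def IsLaplacian {n : ℕ} (L : Matrix (Fin n) (Fin n) ℝ) : Prop :=
  (∀ i j, i ≠ j → L i j ≤ 0) ∧ (∀ i, ∑ j, L i j = 0)

/-- The digraph of `L` (edge `(i,j)` whenever `i ≠ j` and `L i j ≠ 0`) is strongly
connected; this is equivalent to irreducibility of `L`. -/
def StronglyConnected {n : ℕ} (L : Matrix (Fin n) (Fin n) ℝ) : Prop :=
  ∀ i j : Fin n, Relation.ReflTransGen (fun a b => a ≠ b ∧ L a b ≠ 0) i j

theorem lap_nonneg {n : ℕ} (L : Matrix (Fin n) (Fin n) ℝ) (hL : IsLaplacian L)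
    (a c : ℝ) (ha : 0 < a) (hc : 0 < c) (x : Fin n → ℝ)
    (h : ∀ i, 0 ≤ a * x i + c * ∑ j, L i j * x j) (i : Fin n) : 0 ≤ x i := by
  haveI : Nonempty (Fin n) := ⟨i⟩
  obtain ⟨m, hm⟩ := Finite.exists_min x
  refine le_trans ?_ (hm i)
  have h1 : ∑ j, L m j * x j ≤ 0 := by
    have h2 : ∑ j, L m j * x j = ∑ j, L m j * (x j - x m) := by
      simp only [mul_sub, Finset.sum_sub_distrib, ← Finset.sum_mul, hL.2 m]
      ring
    rw [h2]
    refine Finset.sum_nonpos fun j _ => ?_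
    by_cases hj : m = j
    · subst hj; simp
    · exact mul_nonpos_of_nonpos_of_nonneg (hL.1 m j hj) (sub_nonneg.2 (hm j))
  have h3 := h m
  by_contra hneg
  push Not at hneg
  nlinarith [mul_neg_of_pos_of_neg ha hneg, mul_nonneg hc.le (neg_nonneg.2 h1)]

theorem lap_pos {n : ℕ} (L : Matrix (Fin n) (Fin n) ℝ) (hL : IsLaplacian L)
    (hIrr : StronglyConnected L)
    (a c : ℝ) (ha : 0 < a) (hc : 0 < c) (x : Fin n → ℝ)
    (h : ∀ i, 0 ≤ a * x i + c * ∑ j, L i j * x j) (k : Fin n) (hk : x k ≠ 0)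
    (i : Fin n) : 0 < x i := by
  have hx := lap_nonneg L hL a c ha hc x h
  refine lt_of_le_of_ne (hx i) fun h0 => hk ?_
  have step : ∀ p q, (p ≠ q ∧ L p q ≠ 0) → x p = 0 → x q = 0 := by
    rintro p q ⟨hpq, hLpq⟩ hp
    have h1 := h p
    rw [hp, mul_zero, zero_add] at h1
    have h2 : 0 ≤ ∑ j, L p j * x j := nonneg_of_mul_nonneg_right h1 hc
    have h3 : ∀ j ∈ Finset.univ, L p j * x j ≤ 0 := by
      intro j _
      by_cases hj : p = j
      · subst hj; simp [hp]
      · exact mul_nonpos_of_nonpos_of_nonneg (hL.1 p j hj) (hx j)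
    have h4 := (Finset.sum_eq_zero_iff_of_nonpos h3).1
      (le_antisymm (Finset.sum_nonpos h3) h2) q (Finset.mem_univ q)
    exact (mul_eq_zero.1 h4).resolve_left hLpq
  have := hIrr i k
  induction this with
  | refl => exact h0.symm
  | tail _ hbc ih =>
    by_contra hne
    exact hne (step _ _ hbc (by by_contra h5; exact h5 (ih h5)))

/-- For `n ≥ 2`, an irreducible Laplacian `L` and `r, s₀ > 0`:
(a) `s₀² I + (s₀ r + 1) L` is invertible with entrywise strictly positive inverse;
(b) `M = s₀ (s₀² I + (s₀ r + 1) L)⁻¹ (s₀ I + r L)` is row stochastic with entries in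
`(0,1)`, so `I − M` has strictly positive diagonal and strictly negative off-diagonal
entries. -/
theorem stmt19 {n : ℕ} (hn : 2 ≤ n) (L : Matrix (Fin n) (Fin n) ℝ)
    (hL : IsLaplacian L) (hIrr : StronglyConnected L)
    (r : ℝ) (hr : 0 < r) (s₀ : ℝ) (hs₀ : 0 < s₀) :
    IsUnit (s₀ ^ 2 • (1 : Matrix (Fin n) (Fin n) ℝ) + (s₀ * r + 1) • L) ∧
    (∀ i j, 0 < ((s₀ ^ 2 • (1 : Matrix (Fin n) (Fin n) ℝ) + (s₀ * r + 1) • L)⁻¹) i j) ∧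
    let M : Matrix (Fin n) (Fin n) ℝ :=
      s₀ • ((s₀ ^ 2 • (1 : Matrix (Fin n) (Fin n) ℝ) + (s₀ * r + 1) • L)⁻¹
        * (s₀ • (1 : Matrix (Fin n) (Fin n) ℝ) + r • L))
    (∀ i, ∑ j, M i j = 1) ∧
    (∀ i j, 0 < M i j ∧ M i j < 1) ∧
    (∀ i, 0 < ((1 : Matrix (Fin n) (Fin n) ℝ) - M) i i) ∧
    (∀ i j, i ≠ j → ((1 : Matrix (Fin n) (Fin n) ℝ) - M) i j < 0) := by
  obtain ⟨A, hA⟩ : ∃ A, A = s₀ ^ 2 • (1 : Matrix (Fin n) (Fin n) ℝ) + (s₀ * r + 1) • L :=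
    ⟨_, rfl⟩
  rw [← hA]
  have ha : 0 < s₀ ^ 2 := by positivity
  have hc : 0 < s₀ * r + 1 := by positivity
  have hAv : ∀ (x : Fin n → ℝ) i,
      (A *ᵥ x) i = s₀ ^ 2 * x i + (s₀ * r + 1) * ∑ j, L i j * x j := by
    intro x i
    rw [hA, Matrix.add_mulVec, Matrix.smul_mulVec, Matrix.smul_mulVec, Matrix.one_mulVec]
    simp [Matrix.mulVec, dotProduct]
  have hU : IsUnit A := by
    rw [← Matrix.mulVec_injective_iff_isUnit]
    have key : ∀ z : Fin n → ℝ, A *ᵥ z = 0 → ∀ i, 0 ≤ z i := by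
      intro z hz
      refine lap_nonneg L hL _ _ ha hc z fun i => ?_
      rw [← hAv, hz]; simp
    intro x y hxy
    have e1 : A *ᵥ (x - y) = 0 := by
      rw [Matrix.mulVec_sub]; exact sub_eq_zero.2 hxy
    have e2 : A *ᵥ (y - x) = 0 := by
      rw [Matrix.mulVec_sub]; exact sub_eq_zero.2 hxy.symm
    funext i
    have h1 := key _ e1 i
    have h2 := key _ e2 i
    simp only [Pi.sub_apply] at h1 h2
    linarith
  have hdet : IsUnit A.det := (Matrix.isUnit_iff_isUnit_det A).1 hU
  have hAB : A * A⁻¹ = 1 := Matrix.mul_nonsing_inv A hdet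
  have hBA : A⁻¹ * A = 1 := Matrix.nonsing_inv_mul A hdet
  have hpos : ∀ i j, 0 < A⁻¹ i j := by
    intro i j
    have hcol : ∀ i, s₀ ^ 2 * A⁻¹ i j + (s₀ * r + 1) * ∑ k, L i k * A⁻¹ k j
        = (1 : Matrix (Fin n) (Fin n) ℝ) i j := by
      intro i
      rw [← hAB]
      exact (hAv (fun k => A⁻¹ k j) i).symm
    have hne : ∃ k, A⁻¹ k j ≠ 0 := by
      by_contra hall
      push Not at hall
      have := hcol j
      simp [hall] at this
    obtain ⟨k, hk⟩ := hne
    refine lap_pos L hL hIrr _ _ ha hc (fun k => A⁻¹ k j) (fun i => ?_) k hk i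
    rw [hcol i, Matrix.one_apply]
    split_ifs <;> norm_num
  refine ⟨hU, hpos, ?_⟩
  intro M
  have hM : M = (s₀ * r / (s₀ * r + 1)) • (1 : Matrix (Fin n) (Fin n) ℝ)
      + (s₀ ^ 2 / (s₀ * r + 1)) • A⁻¹ := by
    have h1 : s₀ • (1 : Matrix (Fin n) (Fin n) ℝ) + r • L
        = (r / (s₀ * r + 1)) • A + (s₀ / (s₀ * r + 1)) • (1 : Matrix (Fin n) (Fin n) ℝ) := by
      rw [hA]
      ext i j
      simp only [Matrix.add_apply, Matrix.smul_apply, smul_eq_mul]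
      field_simp
      ring
    show s₀ • (A⁻¹ * (s₀ • (1 : Matrix (Fin n) (Fin n) ℝ) + r • L)) = _
    rw [h1, Matrix.mul_add, Matrix.mul_smul, Matrix.mul_smul, hBA, Matrix.mul_one, smul_add,
      smul_smul, smul_smul]
    congr 2 <;> ring
  clear_value M
  have hMij : ∀ i j, M i j = s₀ * r / (s₀ * r + 1) * (1 : Matrix (Fin n) (Fin n) ℝ) i j
      + s₀ ^ 2 / (s₀ * r + 1) * A⁻¹ i j := by
    intro i j; rw [hM]; simp
  have hrow : ∀ i, s₀ ^ 2 * ∑ j, A⁻¹ i j = 1 := by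
    have h1 : A *ᵥ (fun _ => (1 : ℝ)) = fun _ => s₀ ^ 2 := by
      funext i; rw [hAv]; simp [hL.2 i]
    intro i
    have h2 : (A⁻¹ *ᵥ (A *ᵥ (fun _ => (1 : ℝ)))) i = 1 := by
      rw [Matrix.mulVec_mulVec, hBA, Matrix.one_mulVec]
    rw [h1] at h2
    simp only [Matrix.mulVec, dotProduct] at h2
    rw [← h2, Finset.mul_sum]
    exact Finset.sum_congr rfl fun j _ => mul_comm _ _
  have hsum : ∀ i, ∑ j, M i j = 1 := by
    intro i
    simp only [hMij, Finset.sum_add_distrib, ← Finset.mul_sum]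
    have h1 : ∑ j, (1 : Matrix (Fin n) (Fin n) ℝ) i j = 1 := by
      simp [Matrix.one_apply]
    rw [h1, div_mul_eq_mul_div (s₀ ^ 2), hrow i]
    field_simp
  have hMpos : ∀ i j, 0 < M i j := by
    intro i j
    rw [hMij]
    have h1 : 0 ≤ (1 : Matrix (Fin n) (Fin n) ℝ) i j := by
      rw [Matrix.one_apply]; split_ifs <;> norm_num
    have h2 := hpos i j
    positivity
  have hMlt : ∀ i j, M i j < 1 := by
    intro i j
    haveI : Nontrivial (Fin n) := Fin.nontrivial_iff_two_le.2 hn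
    obtain ⟨k, hk⟩ := exists_ne j
    rw [← hsum i]
    exact Finset.single_lt_sum hk (Finset.mem_univ j) (Finset.mem_univ k) (hMpos i k)
      fun l _ _ => (hMpos i l).le
  refine ⟨hsum, fun i j => ⟨hMpos i j, hMlt i j⟩, fun i => ?_, fun i j hij => ?_⟩
  · simpa using hMlt i i
  · simpa [Matrix.one_apply_ne hij] using hMpos i j
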